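/- Let m ≥ 2 and p ≥ 1. Then C(π^(m+1)(1, χ^(m+1)(p))) ≤ m if and only if C(T_{ord_{m+1}(p)+1}^(m+1)) ≤ m, i.e., if and only if ord_{m+1}(p) ∈ V_m. Consequently, since an integer a ≥ 0 lies in the image of ι_m precisely when C(π^(m+1)(1, χ^(m+1)(a))) ≤ m, whether p lies in the image of ι_m depends only on ord_{m+1}(p), and p ∈ Im(ι_m) iff ord_{m+1}(p) ∈ V_m. -/

import Mathlib

open List Filter

open scoped Classical

noncomputable section

/-- The curling number of a finite string: the largest `k` such that
`S = X ++ Y^k` with `Y` nonempty; by convention `curl [] = 1`. -/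
def curl (S : List ℕ) : ℕ :=
  max 1 (sSup {k | ∃ X Y : List ℕ, Y ≠ [] ∧ S = X ++ (List.replicate k Y).flatten})

/-- The prefix of length `n` of the level-`m` Gijswijt sequence `A^(m)`. -/
def gPrefix (m : ℕ) : ℕ → List ℕ
  | 0 => []
  | n + 1 => gPrefix m n ++ [max m (curl (gPrefix m n))]

/-- `gij m p` is the `p`-th term (1-indexed) of the level-`m` Gijswijt sequence `A^(m)`. -/
def gij (m p : ℕ) : ℕ := max m (curl (gPrefix m (p - 1)))

/-- Standing hypothesis: for every `m ≥ 1`, the sets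
`{k ≥ 0 : C(A^(m)[1,k]) ≤ m}` and `{k ≥ 0 : C(A^(m+1)[1,k]) ≤ m}` are infinite. -/
def StandingHyp : Prop :=
  ∀ m : ℕ, 1 ≤ m →
    {k : ℕ | curl (gPrefix m k) ≤ m}.Infinite ∧
    {k : ℕ | curl (gPrefix (m + 1) k) ≤ m}.Infinite

/-- Length of `π^(m)(1,x)`: the `x`-th smallest (0-indexed) element of
`{k : C(A^(m)[1,k]) ≤ m}`. -/
def piLen (m x : ℕ) : ℕ := Nat.nth (fun k => curl (gPrefix m k) ≤ m) x

/-- `π^(m)(1,x)`: the prefix of `A^(m)` with exactly `x` occurrences of `m`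
and curling number at most `m`. -/
def piStr (m x : ℕ) : List ℕ := gPrefix m (piLen m x)

/-- `β^(m)(t)`, the length of `B_t^(m)`. -/
def beta (m t : ℕ) : ℕ := piLen m ((m + 1) ^ (t - 1))

/-- `B_t^(m) := π^(m)(1,(m+1)^(t-1))`. -/
def Bstr (m t : ℕ) : List ℕ := piStr m ((m + 1) ^ (t - 1))

/-- `τ^(m)(t)`, the length of `T_t^(m)`. -/
def tau (m t : ℕ) : ℕ := Nat.nth (fun k => curl (gPrefix (m + 1) k) ≤ m) (t - 1)

/-- `T_t^(m)`: the `t`-th shortest prefix of `A^(m+1)` with curling number at most `m`. -/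
def Tstr (m t : ℕ) : List ℕ := gPrefix (m + 1) (tau m t)

/-- `φ^(m)(n)`: the least `p ≥ 1` with `A^(m)(p) = n`. -/
def phi (m n : ℕ) : ℕ := sInf {p : ℕ | 1 ≤ p ∧ gij m p = n}

/-- `t^(m)(n) = 1 + log_{m+1} #\{i ≤ φ^(m)(n) : A^(m)(i) = m\}`. -/
def tfun (m n : ℕ) : ℕ := 1 + Nat.log (m + 1) ((gPrefix m (phi m n)).count m)

/-- `χ^(b)(a)`: read the base-`b` digits of `a` as base-`(b+1)` digits. -/
def chi (b a : ℕ) : ℕ := Nat.ofDigits (b + 1) (Nat.digits b a)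

/-- `ι_m(t)`: read the base-`(m+2)` digits of the number of occurrences of `m+1`
in `T_t^(m)` as base-`(m+1)` digits. -/
def iota (m t : ℕ) : ℕ :=
  Nat.ofDigits (m + 1) (Nat.digits (m + 2) ((Tstr m t).count (m + 1)))

/-- `ι_m⁻¹(p)`: the largest `x ≥ 1` with `ι_m(x) ≤ p`. -/
def iotaInv (m p : ℕ) : ℕ := sSup {x : ℕ | 1 ≤ x ∧ iota m x ≤ p}

/-- `ord_b(n)`: the `b`-adic valuation of `n`. -/
def ordb (b n : ℕ) : ℕ := sSup {z : ℕ | b ^ z ∣ n}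

/-- The largest base-`b` digit of `n`. -/
def maxdigit (b n : ℕ) : ℕ := (Nat.digits b n).foldr max 0

/-- Auxiliary function for the level-`m` expansion: `lexpAux m a k = a_{m+1+k}`. -/
def lexpAux (m a : ℕ) : ℕ → ℕ
  | 0 => a
  | k + 1 => iota (m + 1 + k) (ordb (m + 1 + k) (lexpAux m a k) + 1)

/-- `lexp m a l = a_l`, the `l`-th term of the level-`m` expansion of `a`. -/
def lexp (m a l : ℕ) : ℕ := lexpAux m a (l - (m + 1))

/-- The last element `n` of `π^(m+1)(1, χ^(m+1)(a))`; the level-`m` expansion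
of `a` is `a_{m+1}, …, a_n`. -/
def levelEnd (m a : ℕ) : ℕ := (piStr (m + 1) (chi (m + 1) a)).getLastD 0

/-- `V_m := {v ≥ 0 : C(T_{v+1}^(m+1)) ≤ m}`. -/
def Vset (m : ℕ) : Set ℕ := {v | curl (Tstr (m + 1) (v + 1)) ≤ m}

/-- `Q := {α ≥ 0 : C(T_{α+1}^(2)) = 1}`. -/
def Qset : Set ℕ := {a | curl (Tstr 2 (a + 1)) = 1}

/-- `R := {(a,b) : a ∈ Q, a < b, no suffix S of T_{a+1}^(2) with T_{a+1}^(2)·S = T_{b+1}^(2)}`. -/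
def Rset : Set (ℕ × ℕ) :=
  {p | p.1 ∈ Qset ∧ p.1 < p.2 ∧
    ¬∃ S : List ℕ, S <:+ Tstr 2 (p.1 + 1) ∧ Tstr 2 (p.1 + 1) ++ S = Tstr 2 (p.2 + 1)}

/-- The digit of `x` in base `b` at (1-indexed) position `i`, i.e. the coefficient
of `b^(i-1)`. -/
def digitAt (b x i : ℕ) : ℕ := (Nat.digits b x).getD (i - 1) 0

/-- `u` is the (1-indexed) position of the second nonzero base-`b` digit of `x`
(the first nonzero digit being at position `ord_b(x)+1`). -/
def IsSecondNonzero (b x u : ℕ) : Prop :=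
  ordb b x + 1 < u ∧ digitAt b x u ≠ 0 ∧
    ∀ i, ordb b x + 1 < i → i < u → digitAt b x i = 0

/-- `𝒮_b`: pairs `(a,a')` with `1 ≤ a < a'` such that for some position `y` the
base-`b` digits of `a` and `a'` agree away from `y` and twice the `y`-th digit of `a`
is at least the `y`-th digit of `a'`. -/
def Sset (b : ℕ) : Set (ℕ × ℕ) :=
  {p | 1 ≤ p.1 ∧ p.1 < p.2 ∧
    ∃ y : ℕ, (∀ i, i ≠ y → (Nat.digits b p.1).getD i 0 = (Nat.digits b p.2).getD i 0) ∧
      (Nat.digits b p.2).getD y 0 ≤ 2 * (Nat.digits b p.1).getD y 0}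

/-- The glue string `S_t^(m)`, so that `T_{t+1}^(m) = T_t^(m) ++ glue m t`. -/
def glue (m t : ℕ) : List ℕ := (gPrefix (m + 1) (tau m (t + 1))).drop (tau m t)

/-- The strings `P_t^(m)`: `P_1^(m) = (m)` and `P_{t+1}^(m) = P_t^(m)·B_t^(m)·S_t^(m)`. -/
def Pstr (m : ℕ) : ℕ → List ℕ
  | 0 => []
  | 1 => [m]
  | t + 2 => Pstr m (t + 1) ++ Bstr m (t + 1) ++ glue m (t + 1)

end

section Curling

theorem bddAbove_curl_exponents (S : List ℕ) :
    BddAbove {k | ∃ X Y : List ℕ, Y ≠ [] ∧ S = X ++ (List.replicate k Y).flatten} := by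
  refine ⟨S.length, ?_⟩
  rintro k ⟨X, Y, hY, rfl⟩
  have : 1 ≤ Y.length := List.length_pos_iff.2 hY
  simp only [List.length_append, List.length_flatten, List.map_replicate, List.sum_replicate,
    smul_eq_mul]
  nlinarith

theorem le_curl {S X Y : List ℕ} {k : ℕ} (hY : Y ≠ [])
    (h : S = X ++ (List.replicate k Y).flatten) : k ≤ curl S :=
  le_max_of_le_right (le_csSup (bddAbove_curl_exponents S) ⟨X, Y, hY, h⟩)

theorem curl_le {S : List ℕ} {n : ℕ} (hn : 1 ≤ n)
    (h : ∀ (k : ℕ) (X Y : List ℕ), Y ≠ [] → S = X ++ (List.replicate k Y).flatten → k ≤ n) :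
    curl S ≤ n := by
  refine max_le hn (csSup_le ⟨0, S, [0], by simp, by simp⟩ ?_)
  rintro k ⟨X, Y, hY, hS⟩
  exact h k X Y hY hS

theorem one_le_curl (S : List ℕ) : 1 ≤ curl S := le_max_left _ _

theorem curl_le_curl_append (S T : List ℕ) : curl T ≤ curl (S ++ T) := by
  refine curl_le (one_le_curl _) fun k X Y hY hT => ?_
  exact le_curl (X := S ++ X) hY (by rw [hT, List.append_assoc])

theorem curl_nil_le {n : ℕ} (hn : 1 ≤ n) : curl [] ≤ n := by
  refine curl_le hn fun k X Y hY h => ?_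
  rcases k with _ | k
  · omega
  · simp [List.replicate_succ, hY] at h

end Curling

section Valuation

theorem pow_dvd_iff_le_ordb {b n z : ℕ} (hb : 2 ≤ b) (hn : 1 ≤ n) :
    b ^ z ∣ n ↔ z ≤ ordb b n := by
  have hbdd : BddAbove {z : ℕ | b ^ z ∣ n} :=
    ⟨n, fun z hz => (Nat.lt_pow_self hb).le.trans (Nat.le_of_dvd hn hz)⟩
  refine ⟨fun h => le_csSup hbdd h, fun h => ?_⟩
  have hmem : b ^ ordb b n ∣ n := Nat.sSup_mem (s := {z : ℕ | b ^ z ∣ n}) ⟨0, by simp⟩ hbdd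
  exact (pow_dvd_pow b h).trans hmem

theorem ordb_eq_of_dvd_iff {b n b' n' : ℕ} (hb : 2 ≤ b) (hn : 1 ≤ n) (hb' : 2 ≤ b') (hn' : 1 ≤ n')
    (h : ∀ z, b ^ z ∣ n ↔ b' ^ z ∣ n') : ordb b n = ordb b' n' := by
  refine eq_of_forall_le_iff fun z => ?_
  rw [← pow_dvd_iff_le_ordb hb hn, ← pow_dvd_iff_le_ordb hb' hn', h]

theorem ordb_add_eq {b n ℓ w : ℕ} (hb : 2 ≤ b) (hn : 1 ≤ n) (hℓ : b ^ w ∣ ℓ)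
    (hnw : ¬ b ^ w ∣ n) : ordb b (n + ℓ) = ordb b n := by
  refine ordb_eq_of_dvd_iff hb (by omega) hb hn fun z => ?_
  rcases le_total z w with hz | hz
  · exact (Nat.dvd_add_iff_left ((pow_dvd_pow b hz).trans hℓ)).symm
  · have h2 : b ^ w ∣ b ^ z := pow_dvd_pow b hz
    exact ⟨fun h => absurd ((Nat.dvd_add_iff_left hℓ).2 (h2.trans h)) hnw,
      fun h => absurd (h2.trans h) hnw⟩

/-- If `ordb b` is `ℓ`-periodic on an interval of at least two periods, then the interval contains
no multiple of the first power of `b` not dividing `ℓ`. -/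
theorem not_dvd_of_ordb_periodic {b ℓ N a z : ℕ} (hb : 2 ≤ b) (hℓ : 1 ≤ ℓ) (hN : 2 ≤ N)
    (hper : ∀ y, a < y → y + ℓ ≤ a + N * ℓ → ordb b y = ordb b (y + ℓ))
    (haz : a < z) (hz : z ≤ a + N * ℓ) : ¬ b ^ (ordb b ℓ + 1) ∣ z := by
  intro hdvd
  have hnot : ¬ b ^ (ordb b ℓ + 1) ∣ ℓ := by
    rw [pow_dvd_iff_le_ordb hb hℓ]; omega
  have hNℓ : 2 * ℓ ≤ N * ℓ := Nat.mul_le_mul_right _ hN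
  rcases le_or_gt (z + ℓ) (a + N * ℓ) with h | h
  · have h1 := (pow_dvd_iff_le_ordb hb (by omega)).1 hdvd
    rw [hper z haz h, ← pow_dvd_iff_le_ordb hb (by omega)] at h1
    exact hnot ((Nat.dvd_add_iff_right hdvd).2 h1)
  · obtain ⟨y, rfl⟩ : ∃ y, z = y + ℓ := ⟨z - ℓ, by omega⟩
    have h1 := (pow_dvd_iff_le_ordb hb (by omega)).1 hdvd
    rw [← hper y (by omega) hz, ← pow_dvd_iff_le_ordb hb (by omega)] at h1
    exact hnot ((Nat.dvd_add_iff_right h1).2 hdvd)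

theorem exists_dvd_mem_Ioc {c : ℕ} (hc : 0 < c) (a : ℕ) : ∃ z, a < z ∧ z ≤ a + c ∧ c ∣ z := by
  refine ⟨a / c * c + c, ?_, ?_, ?_⟩
  · have := Nat.div_add_mod' a c
    have := Nat.mod_lt a hc
    omega
  · have := Nat.div_mul_le_self a c
    omega
  · exact (Nat.dvd_add_self_right).2 (Nat.dvd_mul_left _ _)

theorem not_ordb_periodic {b ℓ N a : ℕ} (hb : 2 ≤ b) (hℓ : 1 ≤ ℓ) (hN : b ≤ N)
    (hper : ∀ y, a < y → y + ℓ ≤ a + N * ℓ → ordb b y = ordb b (y + ℓ)) : False := by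
  obtain ⟨z, h1, h2, h3⟩ := exists_dvd_mem_Ioc (c := b ^ (ordb b ℓ + 1)) (by positivity) a
  refine not_dvd_of_ordb_periodic hb hℓ (hb.trans hN) hper h1 (h2.trans ?_) h3
  have hle : b ^ ordb b ℓ ≤ ℓ :=
    Nat.le_of_dvd hℓ ((pow_dvd_iff_le_ordb hb hℓ).2 le_rfl)
  rw [pow_succ, Nat.mul_comm]
  exact Nat.add_le_add_left (Nat.mul_le_mul hN hle) _

/-- If `ordb b` is `ℓ`-periodic on the last `b - 1` periods before `x`, then `x` has a base-`b`
digit equal to `b - 1`. -/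
theorem exists_digit_of_ordb_periodic {b ℓ N a : ℕ} (hb : 3 ≤ b) (hℓ : 1 ≤ ℓ) (hN : b ≤ N + 1)
    (hper : ∀ y, a < y → y + ℓ ≤ a + N * ℓ → ordb b y = ordb b (y + ℓ)) :
    ∃ w, (a + N * ℓ) / b ^ w % b = b - 1 := by
  refine ⟨ordb b ℓ, ?_⟩
  set w := ordb b ℓ with hw
  set x := a + N * ℓ with hx
  have hle : b ^ w ≤ ℓ := Nat.le_of_dvd hℓ ((pow_dvd_iff_le_ordb (by omega) hℓ).2 le_rfl)
  have hpos : 0 < b ^ w := by positivity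
  have hmod : x / b ^ w % b = x % b ^ (w + 1) / b ^ w := by
    rw [pow_succ, Nat.mod_mul_right_div_self]
  have hlt : x / b ^ w % b < b := Nat.mod_lt _ (by omega)
  suffices h : b - 1 ≤ x / b ^ w % b by omega
  rw [hmod, Nat.le_div_iff_mul_le hpos]
  have hNℓ : (b - 1) * b ^ w ≤ N * ℓ := Nat.mul_le_mul (by omega) hle
  by_contra hcon
  push Not at hcon
  have hdm := Nat.div_add_mod x (b ^ (w + 1))
  have hle' := Nat.mul_div_le x (b ^ (w + 1))
  refine not_dvd_of_ordb_periodic (by omega) hℓ (by omega) hper (z := b ^ (w + 1) * (x / b ^ (w + 1)))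
    ?_ ?_ (Nat.dvd_mul_right _ _) <;> omega

end Valuation

section Blocks

/-- The concatenation of the strings `c :: B` for `B` in `L`. -/
def sepConcat (c : ℕ) (L : List (List ℕ)) : List ℕ := (L.map (c :: ·)).flatten

@[simp] theorem sepConcat_nil (c : ℕ) : sepConcat c [] = [] := rfl

@[simp] theorem sepConcat_cons (c : ℕ) (B : List ℕ) (L : List (List ℕ)) :
    sepConcat c (B :: L) = c :: (B ++ sepConcat c L) := rfl

@[simp] theorem sepConcat_append (c : ℕ) (L K : List (List ℕ)) :
    sepConcat c (L ++ K) = sepConcat c L ++ sepConcat c K := by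
  simp [sepConcat]

theorem exists_eq_append_sepConcat (c : ℕ) (S : List ℕ) :
    ∃ U L, c ∉ U ∧ (∀ B ∈ L, c ∉ B) ∧ S = U ++ sepConcat c L := by
  induction S with
  | nil => exact ⟨[], [], by simp⟩
  | cons x S ih =>
    obtain ⟨U, L, hU, hL, rfl⟩ := ih
    by_cases h : c = x
    · subst h
      exact ⟨[], U :: L, by simp, by simpa using ⟨hU, hL⟩, by simp⟩
    · exact ⟨x :: U, L, by simp [h, hU], hL, by simp⟩

theorem append_cons_inj {c : ℕ} {U U' S S' : List ℕ} (hU : c ∉ U) (hU' : c ∉ U')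
    (h : U ++ c :: S = U' ++ c :: S') : U = U' ∧ S = S' := by
  rcases List.append_eq_append_iff.1 h with ⟨W, hW, h⟩ | ⟨W, hW, h⟩ <;>
    rcases W with _ | ⟨w, W⟩ <;> simp_all

theorem append_sepConcat_inj {c : ℕ} {L L' : List (List ℕ)} {U U' : List ℕ} (hU : c ∉ U)
    (hL : ∀ B ∈ L, c ∉ B) (hU' : c ∉ U') (hL' : ∀ B ∈ L', c ∉ B)
    (h : U ++ sepConcat c L = U' ++ sepConcat c L') : U = U' ∧ L = L' := by
  induction L generalizing L' U U' with
  | nil =>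
    rcases L' with _ | ⟨B', L'⟩
    · simpa using h
    · simp only [sepConcat_nil, List.append_nil] at h
      exact absurd (by simp [h]) hU
  | cons B L ih =>
    rcases L' with _ | ⟨B', L'⟩
    · simp only [sepConcat_nil, List.append_nil] at h
      exact absurd (by simp [← h]) hU'
    · simp only [sepConcat_cons] at h
      obtain ⟨rfl, hS⟩ := append_cons_inj hU hU' h
      obtain ⟨rfl, rfl⟩ := ih (hL B (by simp)) (fun C hC => hL C (by simp [hC]))
        (hL' B' (by simp)) (fun C hC => hL' C (by simp [hC])) hS
      exact ⟨rfl, rfl⟩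

theorem flatten_replicate_sepConcat (c : ℕ) (U u : List ℕ) (L : List (List ℕ)) (k : ℕ) :
    (List.replicate (k + 1) (U ++ sepConcat c (L ++ [u]))).flatten =
      U ++ sepConcat c ((List.replicate k (L ++ [u ++ U])).flatten ++ L ++ [u]) := by
  induction k with
  | zero => simp
  | succ k ih =>
    rw [List.replicate_succ, List.flatten_cons, ih, List.replicate_succ, List.flatten_cons]
    simp

/-- The block decomposition of a string whose suffix is a power of a word containing the
separator. -/
theorem exists_blocks_of_power_suffix {c k : ℕ} {D : List (List ℕ)} {U X Y : List ℕ}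
    (hD : ∀ B ∈ D, c ∉ B) (hU : c ∉ U) (hY : c ∈ Y)
    (h : sepConcat c (D ++ [U]) = X ++ (List.replicate (k + 1) Y).flatten) :
    ∃ A L V, D = A ++ (List.replicate k (L ++ [U ++ V])).flatten ++ L := by
  obtain ⟨V, K, hV, hK, rfl⟩ := exists_eq_append_sepConcat c Y
  rcases List.eq_nil_or_concat' K with rfl | ⟨L, u, rfl⟩
  · simp at hY; exact absurd hY hV
  have hu : c ∉ u := hK u (by simp)
  have hL : ∀ B ∈ L, c ∉ B := fun B hB => hK B (by simp [hB])
  rw [flatten_replicate_sepConcat] at h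
  have hpow : ∀ B ∈ (List.replicate k (L ++ [u ++ V])).flatten ++ L ++ [u], c ∉ B := by
    intro B hB
    simp only [List.mem_append, List.mem_flatten, List.mem_replicate, List.mem_singleton] at hB
    rcases hB with (⟨_, ⟨-, rfl⟩, hB⟩ | hB) | rfl
    · simp only [List.mem_append, List.mem_singleton] at hB
      rcases hB with hB | rfl
      · exact hL B hB
      · simp [hu, hV]
    · exact hL B hB
    · exact hu
  have hDU : ∀ B ∈ D ++ [U], c ∉ B := by
    intro B hB
    simp only [List.mem_append, List.mem_singleton] at hB
    rcases hB with hB | rfl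
    exacts [hD B hB, hU]
  suffices hs : ∃ A, D ++ [U] = (A ++ (List.replicate k (L ++ [u ++ V])).flatten ++ L) ++ [u] by
    obtain ⟨A, hA⟩ := hs
    obtain ⟨h1, h2⟩ := List.append_inj' hA rfl
    simp only [List.cons.injEq, and_true] at h2
    subst h2
    exact ⟨A, L, V, h1⟩
  obtain ⟨W, J, hW, hJ, rfl⟩ := exists_eq_append_sepConcat c X
  rcases List.eq_nil_or_concat' J with rfl | ⟨J, j, rfl⟩
  · refine ⟨[], ?_⟩
    simp only [sepConcat_nil, List.append_nil] at h
    rw [← List.append_assoc W] at h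
    simpa using (append_sepConcat_inj (U := []) (U' := W ++ V) (by simp) hDU (by simp [hW, hV]) hpow
      (by simpa using h)).2
  · refine ⟨J ++ [j ++ V], ?_⟩
    have := (append_sepConcat_inj (U := []) (U' := W)
      (L' := (J ++ [j ++ V]) ++ ((List.replicate k (L ++ [u ++ V])).flatten ++ L ++ [u]))
      (by simp) hDU hW ?_ (by simpa using h)).2
    · simpa using this
    · intro B hB
      rw [List.mem_append] at hB
      rcases hB with hB | hB
      · simp only [List.mem_append, List.mem_singleton] at hB
        rcases hB with hB | rfl
        · exact hJ B (by simp [hB])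
        · simpa [hV] using hJ j (by simp)
      · exact hpow B hB

theorem exists_period_of_power_suffix {c k x : ℕ} {F : ℕ → List ℕ} {U X Y : List ℕ}
    (hk : 2 ≤ k) (hF : ∀ i, c ∉ F i) (hU : c ∉ U) (hY : c ∈ Y)
    (h : sepConcat c ((List.range x).map F) ++ c :: U = X ++ (List.replicate k Y).flatten) :
    ∃ a ℓ V, 1 ≤ ℓ ∧ x + 1 = a + k * ℓ ∧ (∀ i, a ≤ i → i + ℓ < x → F i = F (i + ℓ)) ∧
      F (x - ℓ) = U ++ V := by
  obtain ⟨j, rfl⟩ : ∃ j, k = j + 2 := ⟨k - 2, by omega⟩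
  obtain ⟨A, L, V, hD⟩ := exists_blocks_of_power_suffix (D := (List.range x).map F) (k := j + 1)
    (by simpa using fun i _ => hF i) hU hY (by simpa using h)
  set Q := (List.replicate j (L ++ [U ++ V])).flatten ++ L with hQ
  have h1 : (List.range x).map F = (A ++ (L ++ [U ++ V])) ++ Q := by
    rw [hD, hQ, List.replicate_succ]; simp
  have h2 : (List.range x).map F = A ++ (Q ++ ((U ++ V) :: L)) := by
    rw [hD, hQ, List.replicate_succ']; simp
  have hQl : Q.length = j * (L.length + 1) + L.length := by simp [hQ]
  have hx : x = A.length + (L.length + 1) + Q.length := by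
    have := congrArg List.length h1
    simp only [List.length_map, List.length_range, List.length_append, List.length_cons,
      List.length_nil] at this
    omega
  have hget : ∀ i, i < x → ((List.range x).map F)[i]? = some (F i) := by
    intro i hi; simp [hi]
  refine ⟨A.length, L.length + 1, V, by omega, ?_, ?_, ?_⟩
  · rw [hx, hQl]; ring
  · intro i hi hix
    have e1 := hget (i + (L.length + 1)) hix
    have e2 := hget i (by omega)
    rw [h1, List.getElem?_append_right (by simp; omega)] at e1
    rw [h2, List.getElem?_append_right hi, List.getElem?_append_left (by omega)] at e2
    have : i + (L.length + 1) - (A ++ (L ++ [U ++ V])).length = i - A.length := by simp; omega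
    rw [this, e2] at e1
    simpa using e1
  · have e := hget (x - (L.length + 1)) (by omega)
    rw [h2, List.getElem?_append_right (by omega), List.getElem?_append_right (by omega)] at e
    have : x - (L.length + 1) - A.length - Q.length = 0 := by omega
    rw [this] at e
    simpa using e.symm

theorem map_range_eq_flatten_replicate {α : Type*} {F : ℕ → α} {a ℓ k : ℕ}
    (hper : ∀ i, a ≤ i → i + ℓ < a + k * ℓ → F (i + ℓ) = F i) :
    (List.range (a + k * ℓ)).map F = (List.range a).map F ++
      (List.replicate k ((List.range ℓ).map fun i => F (a + i))).flatten := by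
  induction k with
  | zero => simp
  | succ k ih =>
    have hsh : ∀ j i, i < ℓ → j ≤ k → F (a + j * ℓ + i) = F (a + i) := by
      intro j i hi
      induction j with
      | zero => simp
      | succ j ihj =>
        intro hj
        rw [← ihj (by omega), ← hper (a + j * ℓ + i) (by omega)]
        · congr 1; ring
        · nlinarith
    have e : a + (k + 1) * ℓ = a + k * ℓ + ℓ := by ring
    rw [e, List.range_add, List.map_append, ih, List.replicate_succ', List.flatten_append]
    · simp only [List.map_map, List.flatten_cons, List.flatten_nil, List.append_nil,
        List.append_assoc]
      congr 2
      refine List.map_congr_left fun i hi => ?_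
      exact hsh k i (by simpa using hi) le_rfl
    · intro i hi hik
      exact hper i hi (by rw [e]; omega)

theorem le_curl_sepConcat {c a ℓ k : ℕ} {F : ℕ → List ℕ} (hℓ : 1 ≤ ℓ)
    (hper : ∀ i, a ≤ i → i + ℓ < a + k * ℓ → F (i + ℓ) = F i) :
    k ≤ curl (sepConcat c ((List.range (a + k * ℓ)).map F)) := by
  refine le_curl (X := sepConcat c ((List.range a).map F))
    (Y := sepConcat c ((List.range ℓ).map fun i => F (a + i))) ?_ ?_
  · obtain ⟨ℓ, rfl⟩ : ∃ l, ℓ = l + 1 := ⟨ℓ - 1, by omega⟩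
    simp [List.range_succ]
  · rw [map_range_eq_flatten_replicate hper, sepConcat_append]
    congr 1
    simp [sepConcat, List.map_flatten, List.flatten_flatten]

end Blocks

section Ruler

@[simp] theorem length_gPrefix (m n : ℕ) : (gPrefix m n).length = n := by
  induction n with
  | zero => rfl
  | succ n ih => simp [gPrefix, ih]

theorem le_of_mem_gPrefix {m n a : ℕ} (h : a ∈ gPrefix m n) : m ≤ a := by
  induction n with
  | zero => simp [gPrefix] at h
  | succ n ih =>
    simp only [gPrefix, List.mem_append, List.mem_singleton] at h
    rcases h with h | rfl
    exacts [ih h, le_max_left _ _]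

theorem notMem_gPrefix_succ (m n : ℕ) : m ∉ gPrefix (m + 1) n := fun h => by
  have := le_of_mem_gPrefix h
  omega

theorem count_gPrefix {m : ℕ} (n : ℕ) :
    (gPrefix m n).count m = Nat.count (fun k => curl (gPrefix m k) ≤ m) n := by
  induction n with
  | zero => simp [gPrefix]
  | succ n ih => simp [gPrefix, Nat.count_succ, ih, List.count_singleton]

theorem length_Tstr (m t : ℕ) : (Tstr m t).length = tau m t := length_gPrefix _ _

theorem notMem_Tstr (m t : ℕ) : m ∉ Tstr m t := notMem_gPrefix_succ _ _

variable {m : ℕ}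

theorem tau_succ_strictMono (hinf : {k | curl (gPrefix (m + 1) k) ≤ m}.Infinite) :
    StrictMono fun s => tau m (s + 1) := fun _ _ h => Nat.nth_strictMono hinf h

theorem curl_Tstr_succ_le (hinf : {k | curl (gPrefix (m + 1) k) ≤ m}.Infinite) (s : ℕ) :
    curl (Tstr m (s + 1)) ≤ m := Nat.nth_mem_of_infinite hinf s

theorem Tstr_succ_injective (hinf : {k | curl (gPrefix (m + 1) k) ≤ m}.Infinite) :
    Function.Injective fun s => Tstr m (s + 1) := fun s s' h => by
  refine (tau_succ_strictMono hinf).injective ?_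
  simpa [length_Tstr] using congrArg List.length h

theorem exists_tau_eq {n : ℕ} (h : curl (gPrefix (m + 1) n) ≤ m) : ∃ s, tau m (s + 1) = n :=
  ⟨_, Nat.nth_count (p := fun k => curl (gPrefix (m + 1) k) ≤ m) h⟩

/-- The string `m T_{v(1)+1} m T_{v(2)+1} ⋯ m T_{v(x)+1}` where `v` is the `(m+1)`-adic valuation
and `T_t = T_t^(m)`. -/
noncomputable def ruler (m x : ℕ) : List ℕ :=
  sepConcat m ((List.range x).map fun i => Tstr m (ordb (m + 1) (i + 1) + 1))

theorem ruler_succ (m x : ℕ) :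
    ruler m (x + 1) = ruler m x ++ m :: Tstr m (ordb (m + 1) (x + 1) + 1) := by
  simp [ruler, List.range_succ]

theorem count_ruler (m x : ℕ) : (ruler m x).count m = x := by
  induction x with
  | zero => simp [ruler]
  | succ x ih =>
    rw [ruler_succ, List.count_append, ih, List.count_cons_self,
      List.count_eq_zero_of_not_mem (notMem_Tstr _ _)]

theorem le_curl_of_notMem {c k : ℕ} {S U X Y : List ℕ} (hY : Y ≠ []) (hc : c ∉ Y)
    (h : S ++ c :: U = X ++ (List.replicate k Y).flatten) : k ≤ curl U := by
  have hpow : c ∉ (List.replicate k Y).flatten := by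
    simp only [List.mem_flatten, List.mem_replicate, not_exists, not_and]
    rintro _ ⟨-, rfl⟩
    exact hc
  rcases List.append_eq_append_iff.1 h with ⟨W, hW, h⟩ | ⟨W, hW, h⟩
  · rcases W with _ | ⟨w, W⟩
    · rw [List.nil_append] at h
      exact absurd (by simp [← h]) hpow
    · simp only [List.cons_append, List.cons.injEq] at h
      exact le_curl hY h.2
  · exact absurd (by simp [h]) hpow

theorem exists_ordb_period (hinf : {k | curl (gPrefix (m + 1) k) ≤ m}.Infinite)
    {k x : ℕ} {U X Y : List ℕ} (hk : 2 ≤ k) (hU : m ∉ U) (hY : m ∈ Y)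
    (h : ruler m x ++ m :: U = X ++ (List.replicate k Y).flatten) :
    ∃ a ℓ V, 1 ≤ ℓ ∧ x + 1 = a + k * ℓ ∧
      (∀ y, a < y → y + ℓ ≤ x → ordb (m + 1) y = ordb (m + 1) (y + ℓ)) ∧
      Tstr m (ordb (m + 1) (x + 1 - ℓ) + 1) = U ++ V := by
  obtain ⟨a, ℓ, V, hℓ, hx, hper, hV⟩ :=
    exists_period_of_power_suffix hk (fun i => notMem_Tstr m _) hU hY h
  have hkℓ : 2 * ℓ ≤ k * ℓ := Nat.mul_le_mul_right _ hk
  refine ⟨a, ℓ, V, hℓ, hx, fun y hy hyx => ?_, ?_⟩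
  · obtain ⟨i, rfl⟩ : ∃ i, y = i + 1 := ⟨y - 1, by omega⟩
    have := Tstr_succ_injective hinf (hper i (by omega) (by omega))
    rw [this]
    congr 1
    omega
  · rw [← hV]
    congr 3
    omega

theorem curl_ruler_append_le (hm : 1 ≤ m)
    (hinf : {k | curl (gPrefix (m + 1) k) ≤ m}.Infinite) {x : ℕ} {U : List ℕ} (hU : m ∉ U) :
    curl (ruler m x ++ m :: U) ≤ max (m + 1) (curl U) := by
  refine curl_le (by omega) fun k X Y hY h => ?_
  by_cases hc : m ∈ Y
  · refine le_max_of_le_left ?_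
    by_contra! hk
    obtain ⟨a, ℓ, -, hℓ, hx, hper, -⟩ := exists_ordb_period hinf (by omega) hU hc h
    obtain ⟨N, rfl⟩ : ∃ N, k = N + 1 := ⟨k - 1, by omega⟩
    rw [Nat.succ_mul] at hx
    exact not_ordb_periodic (b := m + 1) (N := N) (by omega) hℓ (by omega)
      fun y hy hyx => hper y hy (by omega)
  · exact le_max_of_le_right (le_curl_of_notMem hY hc h)

theorem exists_full_ordb_period (hm : 1 ≤ m)
    (hinf : {k | curl (gPrefix (m + 1) k) ≤ m}.Infinite)
    {k x : ℕ} {X Y : List ℕ} (hk : 3 ≤ k) (hY : m ∈ Y)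
    (h : ruler m (x + 1) = X ++ (List.replicate k Y).flatten) :
    ∃ a ℓ, 1 ≤ ℓ ∧ x + 1 = a + k * ℓ ∧
      ∀ y, a < y → y + ℓ ≤ a + k * ℓ → ordb (m + 1) y = ordb (m + 1) (y + ℓ) := by
  rw [ruler_succ] at h
  obtain ⟨a, ℓ, V, hℓ, hx, hper, hV⟩ :=
    exists_ordb_period hinf (by omega) (notMem_Tstr m _) hY h
  have hkℓ : 3 * ℓ ≤ k * ℓ := Nat.mul_le_mul_right _ hk
  refine ⟨a, ℓ, hℓ, hx, fun y hy hyx => ?_⟩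
  rcases Nat.lt_or_ge x (y + ℓ) with hlt | hge
  swap
  · exact hper y hy hge
  have hyx' : y + ℓ = x + 1 := by omega
  have hy' : x + 1 - ℓ = y := by omega
  rw [hy', ← hyx'] at hV
  have hlen := congrArg List.length hV
  simp only [List.length_append, length_Tstr] at hlen
  have hle : ordb (m + 1) (y + ℓ) ≤ ordb (m + 1) y :=
    (tau_succ_strictMono hinf).le_iff_le.1 (by omega)
  refine le_antisymm ?_ hle
  have hdvd : (m + 1) ^ ordb (m + 1) y ∣ y :=
    (pow_dvd_iff_le_ordb (by omega) (by omega)).2 le_rfl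
  obtain ⟨z, rfl⟩ : ∃ z, y = z + ℓ := ⟨y - ℓ, by omega⟩
  have hz : (m + 1) ^ ordb (m + 1) (z + ℓ) ∣ z := by
    rw [pow_dvd_iff_le_ordb (by omega) (by omega), hper z (by omega) (by omega)]
  rw [← pow_dvd_iff_le_ordb (by omega) (by omega)]
  exact dvd_add hdvd ((Nat.dvd_add_iff_right hz).2 hdvd)

theorem curl_ruler_le (hm : 2 ≤ m) (hinf : {k | curl (gPrefix (m + 1) k) ≤ m}.Infinite) (x : ℕ) :
    curl (ruler m x) ≤ m := by
  rcases x with _ | x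
  · exact curl_nil_le (by omega)
  refine curl_le (by omega) fun k X Y hY h => ?_
  by_cases hc : m ∈ Y
  · by_contra! hk
    obtain ⟨a, ℓ, hℓ, -, hper⟩ := exists_full_ordb_period (by omega) hinf (by omega) hc h
    exact not_ordb_periodic (b := m + 1) (by omega) hℓ hk hper
  · rw [ruler_succ] at h
    exact (le_curl_of_notMem hY hc h).trans (curl_Tstr_succ_le hinf _)

theorem le_curl_ruler_append (hm : 1 ≤ m) {x s : ℕ} (hs : s < ordb (m + 1) (x + 1)) :
    m + 1 ≤ curl (ruler m x ++ m :: Tstr m (s + 1)) := by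
  set b := m + 1 with hb
  have hdvd : b ^ (s + 1) ∣ x + 1 := (pow_dvd_iff_le_ordb (by omega) (by omega)).2 hs
  have hpos : 0 < b ^ s := by positivity
  obtain ⟨a, ha⟩ : ∃ a, x + 1 = a + b * b ^ s := by
    have := Nat.le_of_dvd (by omega) hdvd
    rw [pow_succ, Nat.mul_comm] at this
    exact ⟨x + 1 - b * b ^ s, by omega⟩
  have hda : b ^ (s + 1) ∣ a := by
    rw [ha, pow_succ, Nat.mul_comm] at hdvd
    rw [pow_succ, Nat.mul_comm]
    exact (Nat.dvd_add_iff_left dvd_rfl).2 hdvd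
  have hnd : ¬ b ^ (s + 1) ∣ b ^ s := by
    rw [Nat.pow_dvd_pow_iff_le_right (by omega)]; omega
  set F : ℕ → List ℕ := fun i => Tstr m ((if i = x then s else ordb b (i + 1)) + 1) with hF
  have hR : ruler m x ++ m :: Tstr m (s + 1) =
      sepConcat m ((List.range (a + b * b ^ s)).map F) := by
    rw [← ha, List.range_succ, List.map_append, sepConcat_append, ruler]
    congr 1
    · congr 1
      refine List.map_congr_left fun i hi => ?_
      have : i ≠ x := by have := List.mem_range.1 hi; omega
      simp [hF, this, hb]
    · simp [hF]
  rw [hR]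
  refine le_curl_sepConcat hpos fun i hi hix => ?_
  have hi' : i ≠ x := by omega
  simp only [hF, hi', if_false]
  congr 2
  by_cases hds : b ^ s ∣ i + 1
  · have hval : ∀ j, b ^ s ∣ j → a < j → j < x + 1 → ordb b j = s := by
      intro j hj haj hjx
      refine le_antisymm ?_ ((pow_dvd_iff_le_ordb (by omega) (by omega)).1 hj)
      by_contra! hlt
      have h1 : b ^ (s + 1) ∣ j := (pow_dvd_iff_le_ordb (by omega) (by omega)).2 hlt
      have h2 : b ^ (s + 1) ∣ j - a := Nat.dvd_sub h1 hda
      have h3 := Nat.le_of_dvd (by omega) h2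
      rw [pow_succ, Nat.mul_comm] at h3
      omega
    rw [hval (i + 1) hds (by omega) (by omega)]
    split_ifs with hcase
    · rfl
    · have : i + b ^ s + 1 = i + 1 + b ^ s := by omega
      rw [this]
      exact hval _ (dvd_add hds dvd_rfl) (by omega) (by omega)
  · have hne : i + b ^ s ≠ x := by
      intro h
      apply hds
      rw [← h] at hdvd
      have : b ^ s ∣ i + b ^ s + 1 := (pow_dvd_pow b (by omega)).trans hdvd
      rw [show i + b ^ s + 1 = i + 1 + b ^ s by omega] at this
      exact (Nat.dvd_add_iff_left dvd_rfl).2 this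
    rw [if_neg hne, show i + b ^ s + 1 = i + 1 + b ^ s by omega]
    exact ordb_add_eq (by omega) (by omega) dvd_rfl hds

/-- The ruler strings are prefixes of the level-`m` Gijswijt sequence. -/
theorem ruler_eq_gPrefix (hm : 2 ≤ m) (hinf : {k | curl (gPrefix (m + 1) k) ≤ m}.Infinite)
    (x : ℕ) : ruler m x = gPrefix m (ruler m x).length := by
  induction x with
  | zero => rfl
  | succ x ih =>
    set v := ordb (m + 1) (x + 1) with hv
    have key : ∀ n, n ≤ tau m (v + 1) →
        ruler m x ++ m :: gPrefix (m + 1) n = gPrefix m ((ruler m x).length + 1 + n) := by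
      intro n
      induction n with
      | zero =>
        intro _
        rw [Nat.add_zero, gPrefix, gPrefix, ← ih, max_eq_left (curl_ruler_le hm hinf x)]
      | succ n ihn =>
        intro hn
        rw [← Nat.add_assoc, gPrefix, gPrefix, ← ihn (by omega), ← List.cons_append,
          ← List.append_assoc]
        congr 2
        have hup := curl_ruler_append_le (x := x) (by omega) hinf (notMem_gPrefix_succ m n)
        have hlow : curl (gPrefix (m + 1) n) ≤ curl (ruler m x ++ m :: gPrefix (m + 1) n) := by
          simpa using curl_le_curl_append (ruler m x ++ [m]) (gPrefix (m + 1) n)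
        have hm1 : m + 1 ≤ curl (ruler m x ++ m :: gPrefix (m + 1) n) := by
          rcases Nat.lt_or_ge m (curl (gPrefix (m + 1) n)) with h | h
          · omega
          · obtain ⟨s, rfl⟩ := exists_tau_eq h
            exact le_curl_ruler_append (by omega)
              ((tau_succ_strictMono hinf).lt_iff_lt.1 (by rw [← hv]; omega))
        omega
    have h := key _ le_rfl
    rw [ruler_succ, Tstr, ← hv, h, length_gPrefix]

theorem piStr_eq_ruler (hm : 2 ≤ m) (hinf : {k | curl (gPrefix (m + 1) k) ≤ m}.Infinite)
    (x : ℕ) : piStr m x = ruler m x := by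
  have h := ruler_eq_gPrefix hm hinf x
  have hc := count_ruler m x
  rw [h, count_gPrefix] at hc
  have hcurl := curl_ruler_le hm hinf x
  rw [h] at hcurl
  rw [piStr, piLen, h]
  nth_rewrite 1 [← hc]
  rw [Nat.nth_count (p := fun k => curl (gPrefix m k) ≤ m) hcurl]

end Ruler

section Digits

theorem digits_chi {b : ℕ} (hb : 2 ≤ b) (a : ℕ) : Nat.digits (b + 1) (chi b a) = Nat.digits b a := by
  refine Nat.digits_ofDigits _ (by omega) _ (fun l hl => ?_) fun h => ?_
  · exact (Nat.digits_lt_base (by omega) hl).trans (Nat.lt_succ_self b)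
  · exact Nat.getLast_digit_ne_zero b (Nat.digits_ne_nil_iff_ne_zero.1 h)

theorem chi_eq {b : ℕ} (hb : 2 ≤ b) (a : ℕ) : chi b a = a % b + (b + 1) * chi b (a / b) := by
  rcases Nat.eq_zero_or_pos a with rfl | ha
  · simp [chi]
  · rw [chi, Nat.digits_def' (by omega) ha, Nat.ofDigits_cons, chi]

theorem pow_succ_dvd_add_mul_iff {b d q z : ℕ} (hd : d < b) :
    b ^ (z + 1) ∣ d + b * q ↔ d = 0 ∧ b ^ z ∣ q := by
  have hb : 0 < b := by omega
  constructor
  · intro h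
    have h1 : b ∣ d := (Nat.dvd_add_iff_left (Nat.dvd_mul_right b q)).2
      ((dvd_pow_self b (by omega)).trans h)
    obtain rfl := Nat.eq_zero_of_dvd_of_lt h1 hd
    rw [Nat.zero_add, pow_succ, Nat.mul_comm] at h
    exact ⟨rfl, Nat.dvd_of_mul_dvd_mul_left hb h⟩
  · rintro ⟨rfl, h⟩
    rw [Nat.zero_add, pow_succ, Nat.mul_comm]
    exact Nat.mul_dvd_mul_left b h

theorem pow_dvd_chi_iff {b : ℕ} (hb : 2 ≤ b) (z a : ℕ) : b ^ z ∣ a ↔ (b + 1) ^ z ∣ chi b a := by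
  induction z generalizing a with
  | zero => simp
  | succ z ih =>
    have hmod : a % b < b := Nat.mod_lt _ (by omega)
    rw [chi_eq hb, pow_succ_dvd_add_mul_iff (by omega), ← ih]
    nth_rewrite 1 [← Nat.mod_add_div a b]
    exact pow_succ_dvd_add_mul_iff hmod

theorem chi_pos {b a : ℕ} (hb : 2 ≤ b) (ha : 1 ≤ a) : 1 ≤ chi b a := by
  by_contra! h
  have := digits_chi hb a
  rw [show chi b a = 0 by omega, Nat.digits_zero, eq_comm, Nat.digits_eq_nil_iff_eq_zero] at this
  omega

theorem ordb_chi {b a : ℕ} (hb : 2 ≤ b) (ha : 1 ≤ a) : ordb (b + 1) (chi b a) = ordb b a :=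
  (ordb_eq_of_dvd_iff hb ha (by omega) (chi_pos hb ha) fun z => pow_dvd_chi_iff hb z a).symm

theorem chi_ofDigits_digits {b x : ℕ} (hb : 2 ≤ b)
    (hx : ∀ d ∈ Nat.digits (b + 1) x, d < b) :
    chi b (Nat.ofDigits b (Nat.digits (b + 1) x)) = x := by
  rw [chi, Nat.digits_ofDigits b (by omega) _ hx, Nat.ofDigits_digits]
  exact fun h => Nat.getLast_digit_ne_zero _ (Nat.digits_ne_nil_iff_ne_zero.1 h)

theorem chi_digit_ne {b : ℕ} (hb : 2 ≤ b) (a w : ℕ) : chi b a / (b + 1) ^ w % (b + 1) ≠ b := by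
  rw [← Nat.getD_digits _ _ (by omega), digits_chi hb, Nat.getD_digits _ _ hb]
  exact (Nat.mod_lt _ (by omega)).ne

end Digits

section Image

variable {m : ℕ}

/-- A base-`(m+1)` digit equal to `m` in `x` creates an `m`-th power at the end of the ruler
string. -/
theorem le_curl_ruler_of_digit (hm : 1 ≤ m) {x w : ℕ} (hw : x / (m + 1) ^ w % (m + 1) = m) :
    m ≤ curl (ruler m x) := by
  set b := m + 1 with hb
  have hpos : 0 < b ^ w := by positivity
  have hdm := Nat.div_add_mod' x (b ^ w)
  have hdm' := Nat.div_add_mod' (x / b ^ w) b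
  rw [hw] at hdm'
  set q := x / b ^ w / b
  set r := x % b ^ w
  have hrlt : r < b ^ w := Nat.mod_lt _ hpos
  have hx : x = q * b * b ^ w + r + m * b ^ w := by
    rw [← hdm, ← hdm']; ring
  clear_value q r
  rw [ruler, hx]
  refine le_curl_sepConcat hpos fun i hi hix => ?_
  congr 2
  rw [show i + b ^ w + 1 = i + 1 + b ^ w by omega]
  by_cases hds : b ^ w ∣ i + 1
  · have hval : ∀ j, b ^ w ∣ j → q * b * b ^ w < j → j < q * b * b ^ w + b * b ^ w →
        ordb b j = w := by
      intro j hj hqj hjq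
      refine le_antisymm ?_ ((pow_dvd_iff_le_ordb (by omega) (by omega)).1 hj)
      by_contra! hlt
      have h1 : b ^ (w + 1) ∣ j := (pow_dvd_iff_le_ordb (by omega) (by omega)).2 hlt
      rw [pow_succ, Nat.mul_comm] at h1
      have h2 : b * b ^ w ∣ j - q * b * b ^ w :=
        Nat.dvd_sub h1 (by rw [Nat.mul_assoc]; exact Nat.dvd_mul_left _ _)
      have h3 := Nat.le_of_dvd (by omega) h2
      omega
    have hbm : b * b ^ w = m * b ^ w + b ^ w := by rw [hb]; ring
    rw [hval _ (dvd_add hds dvd_rfl) (by omega) (by omega), hval _ hds (by omega) (by omega)]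
  · exact ordb_add_eq (by omega) (by omega) dvd_rfl hds

theorem curl_ruler_le_iff (hm : 2 ≤ m)
    (hinf : {k | curl (gPrefix (m + 1 + 1) k) ≤ m + 1}.Infinite) {x : ℕ} (hx : 1 ≤ x)
    (hdig : ∀ w, x / (m + 1 + 1) ^ w % (m + 1 + 1) ≠ m + 1) :
    curl (ruler (m + 1) x) ≤ m ↔ curl (Tstr (m + 1) (ordb (m + 1 + 1) x + 1)) ≤ m := by
  obtain ⟨x, rfl⟩ : ∃ y, x = y + 1 := ⟨x - 1, by omega⟩
  constructor
  · rw [ruler_succ, ← List.singleton_append, ← List.append_assoc]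
    exact (curl_le_curl_append _ _).trans
  · intro hT
    refine curl_le (by omega) fun k X Y hY h => ?_
    by_cases hc : m + 1 ∈ Y
    · by_contra! hk
      obtain ⟨a, ℓ, hℓ, hx', hper⟩ :=
        exists_full_ordb_period (by omega) hinf (by omega) hc h
      obtain ⟨w, hw⟩ := exists_digit_of_ordb_periodic (by omega) hℓ (by omega) hper
      rw [← hx'] at hw
      exact hdig w hw
    · rw [ruler_succ] at h
      exact (le_curl_of_notMem hY hc h).trans hT

theorem exists_iota_eq_iff (hm : 2 ≤ m) (hinf : {k | curl (gPrefix (m + 1) k) ≤ m}.Infinite)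
    (hinf' : {k | curl (gPrefix (m + 1) k) ≤ m + 1}.Infinite)
    (hinf'' : {k | curl (gPrefix (m + 1 + 1) k) ≤ m + 1}.Infinite) (p : ℕ) :
    (∃ t : ℕ, 1 ≤ t ∧ iota m t = p) ↔ curl (piStr (m + 1) (chi (m + 1) p)) ≤ m := by
  constructor
  · rintro ⟨t, ht, rfl⟩
    obtain ⟨s, rfl⟩ : ∃ s, t = s + 1 := ⟨t - 1, by omega⟩
    have hcurl := curl_Tstr_succ_le hinf s
    set x := (Tstr m (s + 1)).count (m + 1) with hx
    have hpi : piStr (m + 1) x = Tstr m (s + 1) := by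
      rw [piStr, piLen, hx, Tstr, count_gPrefix,
        Nat.nth_count (p := fun k => curl (gPrefix (m + 1) k) ≤ m + 1) (hcurl.trans (by omega))]
    rw [iota, ← hx, chi_ofDigits_digits (by omega), hpi]
    · exact hcurl
    · intro d hd
      by_contra! hdm
      have hlt := Nat.digits_lt_base (by omega) hd
      obtain rfl : d = m + 1 := by omega
      obtain ⟨w, hw, hget⟩ := List.getElem_of_mem hd
      have hdig := Nat.getD_digits x w (b := m + 1 + 1) (by omega)
      rw [List.getD_eq_getElem _ _ hw, hget] at hdig
      have := le_curl_ruler_of_digit (by omega) hdig.symm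
      rw [← piStr_eq_ruler (by omega) hinf'', hpi] at this
      omega
  · intro h
    obtain ⟨s, hs⟩ := exists_tau_eq (m := m) h
    refine ⟨s + 1, by omega, ?_⟩
    rw [iota, Tstr, hs, count_gPrefix, piLen, Nat.count_nth_of_infinite hinf', digits_chi (by omega),
      Nat.ofDigits_digits]

end Image

/-- Corollary `depends on the order`. For `m ≥ 2` and `p ≥ 1`:
`C(π^(m+1)(1,χ^(m+1)(p))) ≤ m` iff `C(T_{ord_{m+1}(p)+1}^(m+1)) ≤ m`, i.e. iff
`ord_{m+1}(p) ∈ V_m`; consequently `p ∈ Im(ι_m)` iff `ord_{m+1}(p) ∈ V_m`. -/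
theorem statement4 (hSH : StandingHyp) (m p : ℕ) (hm : 2 ≤ m) (hp : 1 ≤ p) :
    (curl (piStr (m + 1) (chi (m + 1) p)) ≤ m ↔
      curl (Tstr (m + 1) (ordb (m + 1) p + 1)) ≤ m) ∧
    (curl (piStr (m + 1) (chi (m + 1) p)) ≤ m ↔ ordb (m + 1) p ∈ Vset m) ∧
    ((∃ t : ℕ, 1 ≤ t ∧ iota m t = p) ↔ curl (piStr (m + 1) (chi (m + 1) p)) ≤ m) ∧
    ((∃ t : ℕ, 1 ≤ t ∧ iota m t = p) ↔ ordb (m + 1) p ∈ Vset m) := by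
  have hinf := (hSH (m + 1) (by omega)).2
  have h3 := exists_iota_eq_iff hm (hSH m (by omega)).2 (hSH (m + 1) (by omega)).1 hinf p
  have h1 : curl (piStr (m + 1) (chi (m + 1) p)) ≤ m ↔
      curl (Tstr (m + 1) (ordb (m + 1) p + 1)) ≤ m := by
    rw [piStr_eq_ruler (by omega) hinf, curl_ruler_le_iff hm hinf (chi_pos (by omega) hp)
      (chi_digit_ne (by omega) p), ordb_chi (by omega) hp]
  exact ⟨h1, h1, h3, h3.trans h1⟩
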